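/- (Inconsistency of adaptive PGD) Fix D ≥ 1 and real p, q > 1 with 1/p + 1/q = 1. There exist two binary linear classifiers f₁, f₂ on ℝ^D, sampling probabilities α = (1/2, 1/2), a labeled point (x, y) ∈ ℝ^D × {−1, 1}, and ε > 0 such that: (i) y·f₁(x) > 0 and y·f₂(x) > 0, so L(x, y, α) = 1; (ii) there exists δ ∈ ℝ^D with ‖δ‖_p ≤ ε and L(x + δ, y, α) < 1; and yet (iii) the gradient of the expected binary cross-entropy loss vanishes at x: ∇_x ((1/2)·l₁(x, y) + (1/2)·l₂(x, y)) = 0, so any iteration that moves along this gradient starting from the zero perturbation remains stationary and produces no adversarial perturbation. -/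

import Mathlib

open scoped RealInnerProductSpace BigOperators Gradient

/-- The ℓp norm `(∑ i, |v i|^p)^(1/p)` on `ℝ^D` for a real exponent `p`. -/
noncomputable def lpNorm {D : ℕ} (p : ℝ) (v : EuclideanSpace ℝ (Fin D)) : ℝ :=
  (∑ i, |v i| ^ p) ^ (1 / p)

open Classical in
/-- Real-valued indicator of a proposition. -/
noncomputable def ind (P : Prop) : ℝ := if P then 1 else 0

/-- The binary cross-entropy loss of the binary linear classifier `f(u) = ⟪w, u⟫ + b`
at the labeled point `(x, y)` with `y ∈ {−1, 1}`. -/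
noncomputable def bceLoss {D : ℕ} (w : EuclideanSpace ℝ (Fin D)) (b y : ℝ)
    (x : EuclideanSpace ℝ (Fin D)) : ℝ :=
  -((1 + y) / 2) * Real.log (Real.exp (⟪w, x⟫ + b) / (1 + Real.exp (⟪w, x⟫ + b)))
    - ((1 - y) / 2) * Real.log (1 / (1 + Real.exp (⟪w, x⟫ + b)))

/-- The gradient of an even function vanishes at the origin. -/
theorem Function.Even.gradient_zero {E : Type*} [NormedAddCommGroup E] [InnerProductSpace ℝ E]
    [CompleteSpace E] {f : E → ℝ} (hf : Function.Even f) : ∇ f 0 = 0 := by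
  have h := (ContinuousLinearEquiv.neg ℝ (M := E)).comp_right_fderiv (f := f) (x := 0)
  have hcomp : f ∘ ContinuousLinearEquiv.neg ℝ (M := E) = f := funext hf
  rw [hcomp, map_zero] at h
  have hzero : fderiv ℝ f 0 = 0 := by
    ext v
    have hv : fderiv ℝ f 0 v = fderiv ℝ f 0 (-v) := DFunLike.congr_fun h v
    rw [map_neg] at hv
    exact self_eq_neg.mp hv
  rw [gradient, hzero, map_zero]

theorem bceLoss_neg {D : ℕ} (w : EuclideanSpace ℝ (Fin D)) (b y : ℝ)
    (x : EuclideanSpace ℝ (Fin D)) : bceLoss w b y (-x) = bceLoss (-w) b y x := by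
  simp only [bceLoss, inner_neg_left, inner_neg_right]

/-- (Inconsistency of adaptive PGD.) There is a randomized ensemble of two binary linear
classifiers with equiprobable sampling, a correctly classified labeled point `(x, y)`
(so `L(x, y, α) = 1`), and a radius `ε > 0` for which an ℓp-norm-bounded adversarial
perturbation exists, yet the gradient of the expected binary cross-entropy loss vanishes
at `x`, so that gradient iterations started from the zero perturbation stay stationary. -/
theorem apgd_inconsistent
    {D : ℕ} (hD : 1 ≤ D) (p q : ℝ) (hp : 1 < p) (hq : 1 < q)
    (hpq : 1 / p + 1 / q = 1) :
    ∃ (w₁ w₂ : EuclideanSpace ℝ (Fin D)) (b₁ b₂ : ℝ) (x : EuclideanSpace ℝ (Fin D))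
      (y ε : ℝ),
      (y = -1 ∨ y = 1) ∧ 0 < ε ∧
      0 < y * (⟪w₁, x⟫ + b₁) ∧ 0 < y * (⟪w₂, x⟫ + b₂) ∧
      (1 / 2) * ind (0 < y * (⟪w₁, x⟫ + b₁)) + (1 / 2) * ind (0 < y * (⟪w₂, x⟫ + b₂)) = 1 ∧
      (∃ δ : EuclideanSpace ℝ (Fin D), lpNorm p δ ≤ ε ∧
        (1 / 2) * ind (0 < y * (⟪w₁, x + δ⟫ + b₁))
          + (1 / 2) * ind (0 < y * (⟪w₂, x + δ⟫ + b₂)) < 1) ∧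
      ∇ (fun z => (1 / 2) * bceLoss w₁ b₁ y z + (1 / 2) * bceLoss w₂ b₂ y z) x = 0 := by
  let e : EuclideanSpace ℝ (Fin D) := EuclideanSpace.single ⟨0, hD⟩ 1
  have he : ⟪e, (-2 : ℝ) • e⟫ = -2 := by
    rw [real_inner_smul_right, real_inner_self_eq_norm_sq]
    simp [e]
  have hnorm : 0 ≤ lpNorm p ((-2 : ℝ) • e) := by
    unfold lpNorm
    positivity
  refine ⟨e, -e, 1, 1, 0, 1, lpNorm p ((-2 : ℝ) • e) + 1, Or.inr rfl, by positivity,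
    by simp, by simp, by norm_num [ind], ⟨(-2 : ℝ) • e, by linarith, ?_⟩, ?_⟩
  · rw [zero_add, inner_neg_left, he]
    norm_num [ind]
  · refine Function.Even.gradient_zero fun z => ?_
    rw [bceLoss_neg, bceLoss_neg, neg_neg, add_comm]
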